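/- arXiv:1403.3582 — 6 statements merged into one kernel-verified Lean document; each statement's English description precedes it below -/
import Mathlib

section
/- Let d ≥ 1, let U_1, …, U_K be unitary matrices in Matrix (Fin d) (Fin d) ℂ, and let α_1, …, α_K be strictly positive real numbers. For any X : Matrix (Fin d) (Fin d) ℂ, one has ∑_{k=1}^{K} α_k • (U_k X U_k† − X) = 0 if and only if U_k X = X U_k for every k. In other words, the kernel of the Lindblad generator with unitary noise operators U_k and weights α_k is exactly the commutant of {U_1, …, U_K}. -/
open scoped Matrix

theorem key_aux {d : ℕ} (U X : Matrix (Fin d) (Fin d) ℂ)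
    (h : Uᴴ * U = 1) :
    ((U * X * Uᴴ - X)ᴴ * (U * X * Uᴴ - X)).trace.re
      = -2 * (Xᴴ * (U * X * Uᴴ - X)).trace.re := by
  have h1 : ((U * X * Uᴴ)ᴴ * (U * X * Uᴴ)).trace = (Xᴴ * X).trace := by
    have : (U * X * Uᴴ)ᴴ * (U * X * Uᴴ) = U * (Xᴴ * ((Uᴴ * U) * (X * Uᴴ))) := by
      simp [Matrix.conjTranspose_mul, Matrix.mul_assoc]
    rw [this, h, Matrix.one_mul, Matrix.trace_mul_comm, ← Matrix.mul_assoc, Matrix.mul_assoc, h,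
      Matrix.mul_one]
  have h2 : ((U * X * Uᴴ)ᴴ * X).trace.re = (Xᴴ * (U * X * Uᴴ)).trace.re := by
    have : (U * X * Uᴴ)ᴴ * X = (Xᴴ * (U * X * Uᴴ))ᴴ := by
      rw [Matrix.conjTranspose_mul Xᴴ, Matrix.conjTranspose_conjTranspose]
    rw [this, Matrix.trace_conjTranspose]
    simp
  rw [Matrix.conjTranspose_sub, Matrix.sub_mul, Matrix.mul_sub, Matrix.mul_sub]
  simp only [Matrix.trace_sub, Complex.sub_re, h1, h2]
  ring

open ComplexOrder in
theorem nn_aux {d : ℕ} (A : Matrix (Fin d) (Fin d) ℂ) :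
    0 ≤ (Aᴴ * A).trace.re ∧ (Aᴴ * A).trace.im = 0 := by
  have h := Complex.le_def.mp (Matrix.posSemidef_conjTranspose_mul_self A).trace_nonneg
  exact ⟨h.1, h.2.symm⟩

theorem stmt_0 (d K : ℕ) (hd : 1 ≤ d)
    (U : Fin K → Matrix (Fin d) (Fin d) ℂ)
    (hU : ∀ k, U k ∈ Matrix.unitaryGroup (Fin d) ℂ)
    (α : Fin K → ℝ) (hα : ∀ k, 0 < α k)
    (X : Matrix (Fin d) (Fin d) ℂ) :
    ∑ k : Fin K, α k • (U k * X * (U k)ᴴ - X) = 0 ↔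
      ∀ k : Fin K, U k * X = X * U k := by
  have hl : ∀ k, (U k)ᴴ * U k = 1 := fun k => Matrix.mem_unitaryGroup_iff'.mp (hU k)
  have hr : ∀ k, U k * (U k)ᴴ = 1 := fun k => Matrix.mem_unitaryGroup_iff.mp (hU k)
  constructor
  · intro h0 k
    have nn := nn_aux (d := d)
    have hs : ∑ k, α k * (((U k * X * (U k)ᴴ - X)ᴴ * (U k * X * (U k)ᴴ - X)).trace.re) = 0 := by
      have h1 := congrArg (fun M => -2 * (Xᴴ * M).trace.re) h0
      simp only [Matrix.mul_sum, Matrix.trace_sum, Complex.re_sum, Matrix.mul_smul,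
        Matrix.trace_smul, Complex.smul_re, Finset.mul_sum, Matrix.mul_zero,
        Matrix.trace_zero, Complex.zero_re, mul_zero, smul_eq_mul] at h1
      rw [← h1]
      refine Finset.sum_congr rfl fun k _ => ?_
      rw [key_aux _ _ (hl k)]
      ring
    have hk := (Finset.sum_eq_zero_iff_of_nonneg (fun k _ =>
      mul_nonneg (hα k).le (nn _).1)).mp hs k (Finset.mem_univ k)
    have hre := (mul_eq_zero.mp hk).resolve_left (hα k).ne'
    have hz : ((U k * X * (U k)ᴴ - X)ᴴ * (U k * X * (U k)ᴴ - X)).trace = 0 :=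
      Complex.ext hre (nn _).2
    have hA : U k * X * (U k)ᴴ - X = 0 := by
      open ComplexOrder in
      exact Matrix.trace_conjTranspose_mul_self_eq_zero_iff.mp hz
    have hB := sub_eq_zero.mp hA
    calc U k * X = U k * X * ((U k)ᴴ * U k) := by rw [hl, Matrix.mul_one]
      _ = U k * X * (U k)ᴴ * U k := by rw [Matrix.mul_assoc (U k * X)]
      _ = X * U k := by rw [hB]
  · intro h
    refine Finset.sum_eq_zero fun k _ => ?_
    rw [h k, Matrix.mul_assoc, hr, Matrix.mul_one, sub_self, smul_zero]
end

section
/- Let d ≥ 1, let U_1, …, U_K be unitary matrices in Matrix (Fin d) (Fin d) ℂ, and let w_1, …, w_K be strictly positive reals with ∑_k w_k = 1. For any X : Matrix (Fin d) (Fin d) ℂ, the mixed-unitary channel E(X) := ∑_k w_k • (U_k X U_k†) satisfies E(X) = X if and only if U_k X = X U_k for every k; i.e., the fixed-point set of a unital mixed-unitary quantum channel is the commutant of its Kraus unitaries. -/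
open scoped Matrix

theorem stmt_1 (d K : ℕ) (hd : 1 ≤ d)
    (U : Fin K → Matrix (Fin d) (Fin d) ℂ)
    (hU : ∀ k, U k ∈ Matrix.unitaryGroup (Fin d) ℂ)
    (w : Fin K → ℝ) (hw : ∀ k, 0 < w k) (hsum : ∑ k : Fin K, w k = 1)
    (X : Matrix (Fin d) (Fin d) ℂ) :
    ∑ k : Fin K, w k • (U k * X * (U k)ᴴ) = X ↔
      ∀ k : Fin K, U k * X = X * U k := by
  have h1 : ∀ k, (U k)ᴴ * U k = 1 := fun k => Matrix.mem_unitaryGroup_iff'.1 (hU k)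
  have h2 : ∀ k, U k * (U k)ᴴ = 1 := fun k => Matrix.mem_unitaryGroup_iff.1 (hU k)
  constructor
  · intro h
    set Y : Fin K → Matrix (Fin d) (Fin d) ℂ := fun k => U k * X * (U k)ᴴ with hY
    have hE : ∑ k, w k • Y k = X := h
    have hE' : ∑ k, w k • (Y k)ᴴ = Xᴴ := by
      rw [← congrArg Matrix.conjTranspose hE, Matrix.conjTranspose_sum]
      simp [Matrix.conjTranspose_smul]
    have hYY : ∀ k, ((Y k)ᴴ * Y k).trace = (Xᴴ * X).trace := by
      intro k
      have : (Y k)ᴴ * Y k = U k * (Xᴴ * X * (U k)ᴴ) := by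
        simp only [hY, Matrix.conjTranspose_mul, Matrix.conjTranspose_conjTranspose]
        calc _ = U k * Xᴴ * ((U k)ᴴ * U k) * X * (U k)ᴴ := by simp only [Matrix.mul_assoc]
          _ = _ := by rw [h1]; simp only [Matrix.mul_assoc, Matrix.one_mul]
      rw [this, Matrix.trace_mul_comm, Matrix.mul_assoc, h1, Matrix.mul_one]
    have key : ∑ k, w k • ((Y k - X)ᴴ * (Y k - X)).trace = 0 := by
      have e : ∀ k, w k • ((Y k - X)ᴴ * (Y k - X)).trace =
          w k • (2 * (Xᴴ * X).trace) - (((w k • (Y k)ᴴ) * X).trace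
            + (Xᴴ * (w k • Y k)).trace) := by
        intro k
        rw [Matrix.conjTranspose_sub, Matrix.sub_mul, Matrix.mul_sub, Matrix.mul_sub]
        simp only [Matrix.trace_sub, hYY, Matrix.smul_mul, Matrix.mul_smul, Matrix.trace_smul,
          Complex.real_smul]
        ring
      rw [Finset.sum_congr rfl fun k _ => e k, Finset.sum_sub_distrib, Finset.sum_add_distrib,
        ← Finset.sum_smul, hsum, ← Matrix.trace_sum, ← Matrix.trace_sum, ← Finset.sum_mul,
        ← Finset.mul_sum, hE, hE', one_smul]
      ring
    have key' : ∑ k, w k * ((Y k - X)ᴴ * (Y k - X)).trace.re = 0 := by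
      simpa using congrArg Complex.re key
    have hn : ∀ k, 0 ≤ ((Y k - X)ᴴ * (Y k - X)).trace.re ∧
        0 = ((Y k - X)ᴴ * (Y k - X)).trace.im := fun k => by
      open scoped ComplexOrder in
      exact Complex.le_def.1 (Matrix.posSemidef_conjTranspose_mul_self (Y k - X)).trace_nonneg
    intro k
    have hz := (Finset.sum_eq_zero_iff_of_nonneg (fun k _ =>
      mul_nonneg (hw k).le (hn k).1)).1 key' k (Finset.mem_univ k)
    have hre := (mul_eq_zero.1 hz).resolve_left (hw k).ne'
    have ht : ((Y k - X)ᴴ * (Y k - X)).trace = 0 :=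
      Complex.ext hre (hn k).2.symm
    have hYX : Y k = X := by
      open scoped ComplexOrder in
      exact sub_eq_zero.1 (Matrix.trace_conjTranspose_mul_self_eq_zero_iff.1 ht)
    calc U k * X = Y k * U k := by simp only [hY]; rw [Matrix.mul_assoc _ _ (U k), h1, Matrix.mul_one]
      _ = X * U k := by rw [hYX]
  · intro h
    have : ∀ k, w k • (U k * X * (U k)ᴴ) = w k • X := fun k => by
      rw [h, Matrix.mul_assoc, h2, Matrix.mul_one]
    rw [Finset.sum_congr rfl fun k _ => this k, ← Finset.sum_smul, hsum, one_smul]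
end

section
/- Suppose the elements g k (k ∈ K) generate G, i.e. Subgroup.closure {g k | k ∈ K} = ⊤. Then for every X : Matrix (Fin d) (Fin d) ℂ the following are equivalent: (i) L(X) = 0; (ii) U g * X = X * U g for every g ∈ G; (iii) Ē(X) = X. In particular, the fixed points of the quasi-local symmetrizing generator are exactly the G-invariant operators. -/
open scoped Matrix

/-- The symmetrizing map `Ē(X) = (1/|G|) ∑_{g ∈ G} (U g) X (U g)†`. -/
noncomputable def symmMap {G : Type*} [Group G] [Fintype G] {d : ℕ}
    (U : G →* Matrix.unitaryGroup (Fin d) ℂ)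
    (X : Matrix (Fin d) (Fin d) ℂ) : Matrix (Fin d) (Fin d) ℂ :=
  ((Fintype.card G : ℂ)⁻¹) •
    ∑ g : G, (U g : Matrix (Fin d) (Fin d) ℂ) * X * ((U g : Matrix (Fin d) (Fin d) ℂ))ᴴ

/-- The Lindblad generator `L(X) = ∑_k α k • (U (g k) X (U (g k))† − X)`. -/
noncomputable def lindblad {G : Type*} [Group G] {d : ℕ} {K : Type*} [Fintype K]
    (U : G →* Matrix.unitaryGroup (Fin d) ℂ) (g : K → G) (α : K → ℝ) :
    Matrix (Fin d) (Fin d) ℂ →ₗ[ℂ] Matrix (Fin d) (Fin d) ℂ where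
  toFun X := ∑ k : K, α k •
    ((U (g k) : Matrix (Fin d) (Fin d) ℂ) * X * ((U (g k) : Matrix (Fin d) (Fin d) ℂ))ᴴ - X)
  map_add' X Y := by
    rw [← Finset.sum_add_distrib]
    refine Finset.sum_congr rfl fun k _ => ?_
    rw [← smul_add]
    congr 1
    noncomm_ring
  map_smul' c X := by
    rw [RingHom.id_apply, Finset.smul_sum]
    refine Finset.sum_congr rfl fun k _ => ?_
    rw [smul_comm]
    congr 1
    rw [smul_sub, Matrix.mul_smul, Matrix.smul_mul]

lemma aux_comm {d : ℕ} (V : Matrix.unitaryGroup (Fin d) ℂ) (X : Matrix (Fin d) (Fin d) ℂ) :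
    (V : Matrix (Fin d) (Fin d) ℂ) * X * (V : Matrix (Fin d) (Fin d) ℂ)ᴴ = X ↔
      (V : Matrix (Fin d) (Fin d) ℂ) * X = X * (V : Matrix (Fin d) (Fin d) ℂ) := by
  have h1 : (V : Matrix (Fin d) (Fin d) ℂ)ᴴ * (V : Matrix (Fin d) (Fin d) ℂ) = 1 :=
    Unitary.coe_star_mul_self V
  have h2 : (V : Matrix (Fin d) (Fin d) ℂ) * (V : Matrix (Fin d) (Fin d) ℂ)ᴴ = 1 :=
    Unitary.coe_mul_star_self V
  constructor
  · intro h
    conv_rhs => rw [← h]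
    rw [Matrix.mul_assoc, h1, Matrix.mul_one]
  · intro h
    rw [h, Matrix.mul_assoc, h2, Matrix.mul_one]

lemma aux_trace {d : ℕ} (V : Matrix.unitaryGroup (Fin d) ℂ) (X D : Matrix (Fin d) (Fin d) ℂ)
    (hD : D = (V : Matrix (Fin d) (Fin d) ℂ) * X * (V : Matrix (Fin d) (Fin d) ℂ)ᴴ - X) :
    (Dᴴ * D).trace = -((Xᴴ * D).trace + (Dᴴ * X).trace) := by
  have h1 : (V : Matrix (Fin d) (Fin d) ℂ)ᴴ * (V : Matrix (Fin d) (Fin d) ℂ) = 1 :=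
    Unitary.coe_star_mul_self V
  have e : D + X = (V : Matrix (Fin d) (Fin d) ℂ) * X * (V : Matrix (Fin d) (Fin d) ℂ)ᴴ := by
    rw [hD]; abel
  have k : ((D + X)ᴴ * (D + X)).trace = (Xᴴ * X).trace := by
    rw [e]
    generalize (V : Matrix (Fin d) (Fin d) ℂ) = W at h1
    have : (W * X * Wᴴ)ᴴ * (W * X * Wᴴ) = W * (Xᴴ * X * Wᴴ) := by
      simp only [Matrix.conjTranspose_mul, Matrix.conjTranspose_conjTranspose]
      calc _ = W * Xᴴ * (Wᴴ * W) * X * Wᴴ := by noncomm_ring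
        _ = _ := by rw [h1]; noncomm_ring
    rw [this, Matrix.trace_mul_comm, Matrix.mul_assoc, h1, Matrix.mul_one]
  rw [Matrix.conjTranspose_add, Matrix.add_mul, Matrix.mul_add, Matrix.mul_add] at k
  simp only [Matrix.trace_add] at k
  linear_combination k

section
open scoped ComplexOrder

lemma aux_nonneg {d : ℕ} (D : Matrix (Fin d) (Fin d) ℂ) :
    0 ≤ (Dᴴ * D).trace.re ∧ 0 = (Dᴴ * D).trace.im :=
  Complex.nonneg_iff.mp (Matrix.posSemidef_conjTranspose_mul_self D).trace_nonneg

lemma aux_zero {d : ℕ} (D : Matrix (Fin d) (Fin d) ℂ) (h : (Dᴴ * D).trace = 0) : D = 0 :=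
  Matrix.trace_conjTranspose_mul_self_eq_zero_iff.mp h

end

theorem stmt_5 {G : Type*} [Group G] [Fintype G] (d : ℕ) (hd : 1 ≤ d)
    {K : Type*} [Fintype K]
    (U : G →* Matrix.unitaryGroup (Fin d) ℂ) (g : K → G)
    (α : K → ℝ) (hα : ∀ k, 0 < α k)
    (hgen : Subgroup.closure {x : G | ∃ k : K, g k = x} = ⊤)
    (X : Matrix (Fin d) (Fin d) ℂ) :
    (lindblad U g α X = 0 ↔
      ∀ h : G, (U h : Matrix (Fin d) (Fin d) ℂ) * X = X * (U h : Matrix (Fin d) (Fin d) ℂ)) ∧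
    ((∀ h : G, (U h : Matrix (Fin d) (Fin d) ℂ) * X = X * (U h : Matrix (Fin d) (Fin d) ℂ)) ↔
      symmMap U X = X) := by
  refine ⟨⟨fun hL => ?_, fun h => ?_⟩, ⟨fun h => ?_, fun h => ?_⟩⟩
  · have hgk : ∀ k, (U (g k) : Matrix (Fin d) (Fin d) ℂ) * X
        * (U (g k) : Matrix (Fin d) (Fin d) ℂ)ᴴ - X = 0 := by
      change ∑ k : K, α k • ((U (g k) : Matrix (Fin d) (Fin d) ℂ) * X
        * ((U (g k) : Matrix (Fin d) (Fin d) ℂ))ᴴ - X) = 0 at hL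
      have key := fun k => aux_trace (U (g k)) X _ rfl
      generalize hDD : (fun k => (U (g k) : Matrix (Fin d) (Fin d) ℂ) * X
        * (U (g k) : Matrix (Fin d) (Fin d) ℂ)ᴴ - X) = D at *
      have hD : ∀ k, (U (g k) : Matrix (Fin d) (Fin d) ℂ) * X
        * (U (g k) : Matrix (Fin d) (Fin d) ℂ)ᴴ - X = D k := fun k => congrFun hDD k
      simp only [hD] at hL key ⊢
      have s1 : ∑ k, α k • (Xᴴ * D k).trace = 0 := by
        have : (Xᴴ * ∑ k, α k • D k).trace = 0 := by rw [hL]; simp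
        simpa [Finset.mul_sum, Matrix.trace_sum, Matrix.trace_smul] using this
      have s2 : ∑ k, α k • ((D k)ᴴ * X).trace = 0 := by
        have : ((∑ k, α k • D k)ᴴ * X).trace = 0 := by rw [hL]; simp
        simpa [Finset.sum_mul, Matrix.conjTranspose_sum, Matrix.conjTranspose_smul,
          Matrix.trace_sum, Matrix.trace_smul] using this
      have s3 : ∑ k, α k • ((D k)ᴴ * D k).trace = 0 := by
        simp only [key, smul_neg, smul_add, Finset.sum_neg_distrib, Finset.sum_add_distrib, s1, s2]
        simp
      have s4 : ∑ k, α k * ((D k)ᴴ * D k).trace.re = 0 := by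
        have := congrArg Complex.re s3
        simpa using this
      have nn' := fun k => aux_nonneg (D k)
      rw [Finset.sum_eq_zero_iff_of_nonneg
        (fun k _ => mul_nonneg (hα k).le (nn' k).1)] at s4
      intro k
      have := (mul_eq_zero.mp (s4 k (Finset.mem_univ k))).resolve_left (hα k).ne'
      exact aux_zero (D k) (Complex.ext this (nn' k).2.symm)
    intro h
    have hh : h ∈ Subgroup.closure {x : G | ∃ k : K, g k = x} := by rw [hgen]; trivial
    induction hh using Subgroup.closure_induction with
    | mem x hx =>
      obtain ⟨k, rfl⟩ := hx
      exact (aux_comm _ _).mp (sub_eq_zero.mp (hgk k))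
    | one => simp
    | mul x y _ _ hx hy =>
      rw [map_mul, Submonoid.coe_mul, Matrix.mul_assoc, hy, ← Matrix.mul_assoc, hx,
        Matrix.mul_assoc]
    | inv x _ hx =>
      have a1 : (U x⁻¹ : Matrix (Fin d) (Fin d) ℂ) * (U x : Matrix (Fin d) (Fin d) ℂ) = 1 := by
        rw [← Submonoid.coe_mul, ← map_mul]; simp
      have a2 : (U x : Matrix (Fin d) (Fin d) ℂ) * (U x⁻¹ : Matrix (Fin d) (Fin d) ℂ) = 1 := by
        rw [← Submonoid.coe_mul, ← map_mul]; simp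
      generalize (U x⁻¹ : Matrix (Fin d) (Fin d) ℂ) = W at *
      calc W * X = W * (X * (U x : Matrix (Fin d) (Fin d) ℂ)) * W := by
            rw [Matrix.mul_assoc, Matrix.mul_assoc, a2, Matrix.mul_one]
        _ = X * W := by rw [← hx, ← Matrix.mul_assoc W, a1, Matrix.one_mul]
  · change ∑ k : K, α k • ((U (g k) : Matrix (Fin d) (Fin d) ℂ) * X
        * ((U (g k) : Matrix (Fin d) (Fin d) ℂ))ᴴ - X) = 0
    refine Finset.sum_eq_zero fun k _ => ?_
    rw [(aux_comm _ _).mpr (h (g k)), sub_self, smul_zero]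
  · unfold symmMap
    rw [Finset.sum_congr rfl fun k _ => (aux_comm _ _).mpr (h k)]
    have : (Fintype.card G : ℂ) ≠ 0 := by simp
    rw [Finset.sum_const, Finset.card_univ, ← Nat.cast_smul_eq_nsmul ℂ, smul_smul,
      inv_mul_cancel₀ this, one_smul]
  · intro x
    rw [← aux_comm]
    have : (U x : Matrix (Fin d) (Fin d) ℂ) * symmMap U X
        * (U x : Matrix (Fin d) (Fin d) ℂ)ᴴ = symmMap U X := by
      unfold symmMap
      rw [Matrix.mul_smul, Matrix.smul_mul, Finset.mul_sum, Finset.sum_mul]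
      congr 1
      refine Fintype.sum_equiv (Equiv.mulLeft x) _ _ fun y => ?_
      simp only [Equiv.coe_mulLeft, map_mul, Submonoid.coe_mul, Matrix.conjTranspose_mul]
      noncomm_ring
    rwa [h] at this
end

section
/- Suppose S is a set of transpositions in Equiv.Perm (Fin m) (every element of S is a swap Equiv.swap i j with i ≠ j) whose generated subgroup H := Subgroup.closure S is a proper subgroup, H ≠ ⊤. Then there exists a density matrix ρ : Matrix (Fin m → Fin n) (Fin m → Fin n) ℂ (Hermitian, positive semidefinite, with trace 1) such that W σ * ρ * (W σ)† = ρ for every σ ∈ H, while W τ * ρ * (W τ)† ≠ ρ for some τ ∈ Equiv.Perm (Fin m). Hence when the chosen swaps generate only a proper subgroup, the invariant set strictly contains the permutation-invariant states. -/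
open scoped Matrix ComplexOrder

/-- The subsystem-permutation unitary `W σ` on the `m`-fold tensor power of `ℂⁿ`,
realized via the index type `Fin m → Fin n`: `(W σ) f g = 1` if `g = f ∘ σ`, else `0`. -/
noncomputable def permMatrix (m n : ℕ) (σ : Equiv.Perm (Fin m)) :
    Matrix (Fin m → Fin n) (Fin m → Fin n) ℂ :=
  Matrix.of fun f g => if g = f ∘ σ then 1 else 0

theorem permMatrix_conj (m n : ℕ) (σ : Equiv.Perm (Fin m))
    (ρ : Matrix (Fin m → Fin n) (Fin m → Fin n) ℂ) (f g : Fin m → Fin n) :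
    (permMatrix m n σ * ρ * (permMatrix m n σ)ᴴ) f g = ρ (f ∘ σ) (g ∘ σ) := by
  simp [Matrix.mul_apply, permMatrix, Matrix.conjTranspose_apply, apply_ite]

theorem stmt_6 (m n : ℕ) (hm : 2 ≤ m) (hn : 2 ≤ n)
    (S : Set (Equiv.Perm (Fin m)))
    (hS : ∀ s ∈ S, ∃ i j : Fin m, i ≠ j ∧ s = Equiv.swap i j)
    (hH : Subgroup.closure S ≠ ⊤) :
    ∃ ρ : Matrix (Fin m → Fin n) (Fin m → Fin n) ℂ,
      ρ.IsHermitian ∧ ρ.PosSemidef ∧ ρ.trace = 1 ∧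
      (∀ σ ∈ Subgroup.closure S,
        permMatrix m n σ * ρ * (permMatrix m n σ)ᴴ = ρ) ∧
      (∃ τ : Equiv.Perm (Fin m),
        permMatrix m n τ * ρ * (permMatrix m n τ)ᴴ ≠ ρ) := by
  classical
  have hS' : ∀ s ∈ S, s.IsSwap := by
    intro s hs
    obtain ⟨i, j, hij, rfl⟩ := hS s hs
    exact ⟨i, j, hij, rfl⟩
  have hex : ∃ x y : Fin m, ∀ σ ∈ Subgroup.closure S, σ x ≠ y := by
    by_contra! hcon
    apply hH
    haveI : MulAction.IsPretransitive (Subgroup.closure S) (Fin m) :=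
      ⟨fun x y => by
        obtain ⟨σ, hσ, h⟩ := hcon x y
        exact ⟨⟨σ, hσ⟩, h⟩⟩
    exact closure_of_isSwap_of_isPretransitive hS'
  obtain ⟨x, y, hxy⟩ := hex
  let a : Fin n := ⟨0, by omega⟩
  let b : Fin n := ⟨1, by omega⟩
  have hab : b ≠ a := by simp [a, b]
  let f0 : Fin m → Fin n := fun z => if ∃ σ ∈ Subgroup.closure S, σ x = z then b else a
  have hx : f0 x = b := if_pos ⟨1, Subgroup.one_mem _, rfl⟩
  have hy : f0 y = a := if_neg (by rintro ⟨σ, hσ, h⟩; exact hxy σ hσ h)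
  have hinv : ∀ σ ∈ Subgroup.closure S, f0 ∘ σ = f0 := by
    intro σ hσ
    funext z
    have : (∃ τ ∈ Subgroup.closure S, τ x = σ z) ↔ (∃ τ ∈ Subgroup.closure S, τ x = z) := by
      constructor
      · rintro ⟨τ, hτ, h⟩
        exact ⟨σ⁻¹ * τ, Subgroup.mul_mem _ (Subgroup.inv_mem _ hσ) hτ, by simp [h]⟩
      · rintro ⟨τ, hτ, h⟩
        exact ⟨σ * τ, Subgroup.mul_mem _ hσ hτ, by simp [h]⟩
    simp only [f0, Function.comp_apply, this]
  let ρ : Matrix (Fin m → Fin n) (Fin m → Fin n) ℂ :=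
    Matrix.diagonal fun f => if f = f0 then 1 else 0
  have hpos : ρ.PosSemidef := by
    apply Matrix.PosSemidef.diagonal
    intro f
    by_cases h : f = f0 <;> simp [h]
  refine ⟨ρ, hpos.1, hpos, by simp [ρ, Matrix.trace], ?_, Equiv.swap x y, ?_⟩
  · intro σ hσ
    ext f g
    rw [permMatrix_conj]
    have h1 : f ∘ σ = g ∘ σ ↔ f = g := σ.surjective.injective_comp_right.eq_iff
    have h2 : f ∘ σ = f0 ↔ f = f0 := by
      conv_lhs => rw [← hinv σ hσ]
      exact σ.surjective.injective_comp_right.eq_iff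
    simp only [ρ, Matrix.diagonal_apply, h1, h2]
  · intro h
    have h3 := congrFun (congrFun h f0) f0
    rw [permMatrix_conj] at h3
    have h4 : f0 ∘ Equiv.swap x y ≠ f0 := by
      intro h5
      have h6 := congrFun h5 x
      rw [Function.comp_apply, Equiv.swap_apply_left, hx, hy] at h6
      exact hab h6.symm
    simp [ρ, h4] at h3
end

section
/- Dissipation identity for the Hilbert–Schmidt Lyapunov function: for every X : Matrix (Fin d) (Fin d) ℂ, Tr((X − Ē(X)) * L(X)) = −(1/2) ∑_{k ∈ K} α k * Tr((X − (U (g k)) X (U (g k))†)^2). -/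
open scoped Matrix

theorem symmMap_invariant {G : Type*} [Group G] [Fintype G] {d : ℕ}
    (U : G →* Matrix.unitaryGroup (Fin d) ℂ) (h : G)
    (X : Matrix (Fin d) (Fin d) ℂ) :
    (U h : Matrix (Fin d) (Fin d) ℂ)ᴴ * symmMap U X * (U h : Matrix (Fin d) (Fin d) ℂ)
      = symmMap U X := by
  have hinv : ((U h⁻¹ : Matrix.unitaryGroup (Fin d) ℂ) : Matrix (Fin d) (Fin d) ℂ)
      = (U h : Matrix (Fin d) (Fin d) ℂ)ᴴ := by
    rw [map_inv]; rfl
  unfold symmMap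
  rw [Matrix.mul_smul, Matrix.smul_mul, Finset.mul_sum, Finset.sum_mul]
  congr 1
  refine Fintype.sum_equiv (Equiv.mulLeft h⁻¹) _ _ fun x => ?_
  rw [Equiv.coe_mulLeft, map_mul, Submonoid.coe_mul, hinv, Matrix.conjTranspose_mul,
    Matrix.conjTranspose_conjTranspose]
  simp only [Matrix.mul_assoc]

theorem stmt_7 {G : Type*} [Group G] [Fintype G] (d : ℕ) (hd : 1 ≤ d)
    {K : Type*} [Fintype K]
    (U : G →* Matrix.unitaryGroup (Fin d) ℂ) (g : K → G)
    (α : K → ℝ) (hα : ∀ k, 0 < α k)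
    (X : Matrix (Fin d) (Fin d) ℂ) :
    Matrix.trace ((X - symmMap U X) * lindblad U g α X) =
      -(1 / 2 : ℂ) * ∑ k : K, (α k : ℂ) *
        Matrix.trace
          ((X - (U (g k) : Matrix (Fin d) (Fin d) ℂ) * X *
              ((U (g k) : Matrix (Fin d) (Fin d) ℂ))ᴴ) ^ 2) := by
  have hL : lindblad U g α X = ∑ k : K, α k •
    ((U (g k) : Matrix (Fin d) (Fin d) ℂ) * X * ((U (g k) : Matrix (Fin d) (Fin d) ℂ))ᴴ - X) := rfl
  rw [hL, Finset.mul_sum, Matrix.trace_sum, Finset.mul_sum]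
  refine Finset.sum_congr rfl fun k _ => ?_
  have hE := symmMap_invariant U (g k) X
  have hV : (U (g k) : Matrix (Fin d) (Fin d) ℂ)ᴴ * (U (g k) : Matrix (Fin d) (Fin d) ℂ) = 1 :=
    Matrix.UnitaryGroup.star_mul_self (U (g k))
  generalize (U (g k) : Matrix (Fin d) (Fin d) ℂ) = V at *
  generalize symmMap U X = E at *
  have h1 : Matrix.trace (E * (V * X * Vᴴ)) = Matrix.trace (E * X) := by
    conv_rhs => rw [← hE]
    rw [← Matrix.mul_assoc, Matrix.trace_mul_comm]
    simp only [Matrix.mul_assoc]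
  have h2 : Matrix.trace (V * X * Vᴴ * (V * X * Vᴴ)) = Matrix.trace (X * X) := by
    have : V * X * Vᴴ * (V * X * Vᴴ) = V * X * (Vᴴ * V) * (X * Vᴴ) := by
      simp only [Matrix.mul_assoc]
    rw [this, hV, Matrix.mul_one, ← Matrix.mul_assoc, Matrix.trace_mul_comm, ← Matrix.mul_assoc,
      ← Matrix.mul_assoc, hV, Matrix.one_mul]
  generalize V * X * Vᴴ = Y at *
  have h3 := Matrix.trace_mul_comm X Y
  rw [Matrix.mul_smul, Matrix.trace_smul, Complex.real_smul]
  simp only [pow_two, Matrix.sub_mul, Matrix.mul_sub, Matrix.trace_sub, h1, h2, h3]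
  ring
end

section
/- Variance of the relative error of the network-size estimator: for natural numbers m, p with 1 ≤ p ≤ m and 2 ≤ m, working in ℝ, ∑_{k=0}^{p} ((k * m) / p^2 − 1)^2 * C(p, k) * C(m − p, p − k) = ((m − p)^2 / (p^2 * (m − 1))) * C(m, p). Equivalently, with m̂⁻¹ := K / p^2 the estimator of 1/m, the relative error (m̂⁻¹ − m⁻¹)/m⁻¹ has second moment E[((m̂⁻¹ − m⁻¹)/m⁻¹)^2] = (m − p)^2 / (p^2 (m − 1)). -/
theorem aux_V (a b n : ℕ) :
    ∑ k ∈ Finset.range (n + 1), (Nat.choose a k : ℝ) * (Nat.choose b (n - k) : ℝ)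
      = (Nat.choose (a + b) n : ℝ) := by
  rw [Nat.add_choose_eq, Finset.Nat.sum_antidiagonal_eq_sum_range_succ_mk]
  push_cast
  rfl

theorem aux_M1 (a b n : ℕ) :
    ∑ k ∈ Finset.range (n + 2),
      (k : ℝ) * ((Nat.choose (a + 1) k : ℝ) * (Nat.choose b (n + 1 - k) : ℝ))
      = (a + 1) * (Nat.choose (a + b) n : ℝ) := by
  rw [Finset.sum_range_succ', ← aux_V a b n, Finset.mul_sum]
  simp only [Nat.cast_zero, zero_mul, add_zero]
  refine Finset.sum_congr rfl fun k _ => ?_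
  have h : ((a : ℝ) + 1) * (Nat.choose a k : ℝ) = (Nat.choose (a + 1) (k + 1) : ℝ) * (k + 1) := by
    exact_mod_cast Nat.add_one_mul_choose_eq a k
  rw [Nat.add_sub_add_right]
  push_cast
  linear_combination (-(Nat.choose b (n - k) : ℝ)) * h

theorem aux_M2 (a b n : ℕ) :
    ∑ k ∈ Finset.range (n + 3),
      (k : ℝ) * (k - 1) * ((Nat.choose (a + 2) k : ℝ) * (Nat.choose b (n + 2 - k) : ℝ))
      = (a + 2) * ((a + 1) * (Nat.choose (a + b) n : ℝ)) := by
  rw [Finset.sum_range_succ', ← aux_M1, Finset.mul_sum]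
  simp only [Nat.cast_zero, zero_mul, add_zero]
  refine Finset.sum_congr rfl fun k _ => ?_
  have h : ((a : ℝ) + 1 + 1) * (Nat.choose (a + 1) k : ℝ)
      = (Nat.choose (a + 2) (k + 1) : ℝ) * (k + 1) := by
    exact_mod_cast Nat.add_one_mul_choose_eq (a + 1) k
  rw [show n + 2 - (k + 1) = n + 1 - k by omega]
  push_cast
  linear_combination (-(k : ℝ) * (Nat.choose b (n + 1 - k) : ℝ)) * h

theorem stmt_19 (m p : ℕ) (hp : 1 ≤ p) (hpm : p ≤ m) (hm : 2 ≤ m) :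
    ∑ k ∈ Finset.range (p + 1),
        (((k : ℝ) * m) / (p : ℝ) ^ 2 - 1) ^ 2 *
          (Nat.choose p k : ℝ) * (Nat.choose (m - p) (p - k) : ℝ) =
      (((m : ℝ) - p) ^ 2 / ((p : ℝ) ^ 2 * ((m : ℝ) - 1))) * (Nat.choose m p : ℝ) := by
  obtain ⟨b, rfl⟩ := Nat.exists_eq_add_of_le hpm
  rw [Nat.add_sub_cancel_left]
  obtain rfl | ⟨q, rfl⟩ : p = 1 ∨ ∃ q, p = q + 2 := by
    rcases Nat.lt_or_ge p 2 with h | h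
    · left; omega
    · right; exact ⟨p - 2, by omega⟩
  · have hb : (b : ℝ) ≠ 0 := by
      have : b ≠ 0 := by omega
      exact_mod_cast this
    simp [Finset.sum_range_succ]
    field_simp
  · have h0 := aux_V (q + 2) b (q + 2)
    have h1 := aux_M1 (q + 1) b (q + 1)
    have h2 := aux_M2 q b q
    have e1 : ((q : ℝ) + 1 + b + 1) * (Nat.choose (q + 1 + b) (q + 1) : ℝ)
        = (Nat.choose (q + 2 + b) (q + 2) : ℝ) * (q + 1 + 1) := by
      have := Nat.add_one_mul_choose_eq (q + 1 + b) (q + 1)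
      rw [show q + 1 + b + 1 = q + 2 + b by ring] at this
      rw [show (q : ℝ) + 1 + b + 1 = ((q + 2 + b : ℕ) : ℝ) by push_cast; ring]
      exact_mod_cast this
    have e2 : ((q : ℝ) + b + 1) * (Nat.choose (q + b) q : ℝ)
        = (Nat.choose (q + 1 + b) (q + 1) : ℝ) * (q + 1) := by
      have := Nat.add_one_mul_choose_eq (q + b) q
      rw [show q + b + 1 = q + 1 + b by ring] at this
      rw [show (q : ℝ) + b + 1 = ((q + 1 + b : ℕ) : ℝ) by push_cast; ring]
      exact_mod_cast this
    set M : ℝ := ((q + 2 + b : ℕ) : ℝ) with hM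
    set P : ℝ := ((q + 2 : ℕ) : ℝ) with hP
    have key : ∑ k ∈ Finset.range (q + 2 + 1),
        (((k : ℝ) * M) / P ^ 2 - 1) ^ 2 *
          (Nat.choose (q + 2) k : ℝ) * (Nat.choose b (q + 2 - k) : ℝ) =
        (M / P ^ 2) ^ 2 * ((q + 2) * ((q + 1) * (Nat.choose (q + b) q : ℝ)))
        + ((M / P ^ 2) ^ 2 - 2 * (M / P ^ 2)) *
          (((q + 1 : ℕ) + 1) * (Nat.choose (q + 1 + b) (q + 1) : ℝ))
        + (Nat.choose (q + 2 + b) (q + 2) : ℝ) := by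
      rw [← h0, ← h1, ← h2, Finset.mul_sum, Finset.mul_sum, ← Finset.sum_add_distrib,
        ← Finset.sum_add_distrib]
      refine Finset.sum_congr rfl fun k _ => ?_
      ring
    rw [key]
    have hPe : P = (q : ℝ) + 2 := by rw [hP]; push_cast; ring
    have hMe : M = (q : ℝ) + 2 + b := by rw [hM]; push_cast; ring
    rw [hPe, hMe]
    have p1 : (q : ℝ) + 1 ≠ 0 := by positivity
    have p2 : (q : ℝ) + 2 ≠ 0 := by positivity
    have p3 : (q : ℝ) + b + 1 ≠ 0 := by positivity
    have p5 : (q : ℝ) + 2 + b ≠ 0 := by positivity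
    have f1 : (Nat.choose (q + 1 + b) (q + 1) : ℝ)
        = (Nat.choose (q + 2 + b) (q + 2) : ℝ) * (q + 2) / (q + 2 + b) := by
      rw [eq_div_iff p5]; linear_combination e1
    have f2 : (Nat.choose (q + b) q : ℝ)
        = (Nat.choose (q + 1 + b) (q + 1) : ℝ) * (q + 1) / (q + b + 1) := by
      rw [eq_div_iff p3]; linear_combination e2
    rw [f2, f1, show (q : ℝ) + 2 + b - 1 = q + b + 1 by ring]
    push_cast
    field_simp
    ring
end
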